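/- (Mapping property of approximate liftings.) Let μ₁, μ₂ be sub-distributions over countable A₁, A₂, let f₁ : A₁ → B₁, f₂ : A₂ → B₂, and let R ⊆ B₁ × B₂. Then there is an (ε,δ)-approximate lifting of {(a₁,a₂) : (f₁(a₁), f₂(a₂)) ∈ R} relating μ₁ and μ₂ if and only if there is an (ε,δ)-approximate lifting of R relating the pushforward distributions f₁_*(μ₁) and f₂_*(μ₂). -/

import Mathlib

open scoped ENNReal

noncomputable section

/-- A discrete sub-distribution: total mass at most 1. -/
def IsSubDist {A : Type*} (μ : A → ℝ≥0∞) : Prop := ∑' a, μ a ≤ 1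

/-- Mass of a set under `μ`. -/
def setSum {A : Type*} (μ : A → ℝ≥0∞) (S : Set A) : ℝ≥0∞ := ∑' a : S, μ (a : A)

/-- `μ` is a coupling of `(μ₁, μ₂)`: a joint sub-distribution with the given marginals. -/
def IsCoupling {A₁ A₂ : Type*} (μ : A₁ × A₂ → ℝ≥0∞)
    (μ₁ : A₁ → ℝ≥0∞) (μ₂ : A₂ → ℝ≥0∞) : Prop :=
  IsSubDist μ ∧ (∀ a₁, ∑' a₂, μ (a₁, a₂) = μ₁ a₁) ∧ (∀ a₂, ∑' a₁, μ (a₁, a₂) = μ₂ a₂)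

/-- Image of a set under a relation. -/
def relImage {A₁ A₂ : Type*} (R : Set (A₁ × A₂)) (S : Set A₁) : Set A₂ :=
  {a₂ | ∃ a₁ ∈ S, (a₁, a₂) ∈ R}

/-- `R⋆ = R ∪ (A₁ × {⋆}) ∪ ({⋆} × A₂)`, with `⋆` modelled by `none`. -/
def starRel {A₁ A₂ : Type*} (R : Set (A₁ × A₂)) : Set (Option A₁ × Option A₂) :=
  {p | match p with
       | (some a₁, some a₂) => (a₁, a₂) ∈ R
       | (some _, none) => True
       | (none, some _) => True
       | (none, none) => False}

/-- `(ε, δ)`-approximate `R`-lifting of `(μ₁, μ₂)`, witnessed by two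
sub-distributions over `A₁⋆ × A₂⋆` with marginal, support, and ε-distance conditions. -/
def ApproxLift {A₁ A₂ : Type*} (ε δ : ℝ) (R : Set (A₁ × A₂))
    (μ₁ : A₁ → ℝ≥0∞) (μ₂ : A₂ → ℝ≥0∞) : Prop :=
  ∃ μL μR : Option A₁ × Option A₂ → ℝ≥0∞,
    IsSubDist μL ∧ IsSubDist μR ∧
    (∀ a₁, ∑' o, μL (some a₁, o) = μ₁ a₁) ∧ (∀ o, μL (none, o) = 0) ∧
    (∀ a₂, ∑' o, μR (o, some a₂) = μ₂ a₂) ∧ (∀ o, μR (o, none) = 0) ∧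
    {p | μL p ≠ 0} ⊆ starRel R ∧ {p | μR p ≠ 0} ⊆ starRel R ∧
    ∀ S : Set (Option A₁ × Option A₂),
      setSum μL S ≤ ENNReal.ofReal (Real.exp ε) * setSum μR S + ENNReal.ofReal δ

theorem dist_aux {Q : Type*} (νL νR : Q → ℝ≥0∞) (e d : ℝ≥0∞) (he : e ≠ ∞)
    (hR : IsSubDist νR)
    (h : ∀ S : Set Q, setSum νL S ≤ e * setSum νR S + d) :
    ∑' q, (νL q - e * νR q) ≤ d := by
  classical
  let S : Set Q := {q | e * νR q ≤ νL q}
  have h1 : ∑' q, (νL q - e * νR q) = ∑' q : S, (νL q - e * νR q) := by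
    refine (tsum_subtype_eq_of_support_subset ?_).symm
    intro q hq
    simp only [Function.mem_support, ne_eq, tsub_eq_zero_iff_le, not_le] at hq
    exact hq.le
  have hfin : ∑' q : S, e * νR q ≠ ∞ := by
    rw [ENNReal.tsum_mul_left]
    refine ENNReal.mul_ne_top he (ne_top_of_le_ne_top ENNReal.one_ne_top ?_)
    exact (ENNReal.tsum_comp_le_tsum_of_injective Subtype.val_injective νR).trans hR
  rw [h1]
  refine (ENNReal.add_le_add_iff_right hfin).1 ?_
  rw [← ENNReal.tsum_add, ENNReal.tsum_mul_left, add_comm d]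
  refine le_trans (le_of_eq ?_) (h S)
  exact tsum_congr fun q => tsub_add_cancel_of_le q.2

theorem push_dist {Q P : Type*} (νL νR : Q → ℝ≥0∞) (e d : ℝ≥0∞) (he : e ≠ ∞)
    (hR : IsSubDist νR)
    (h : ∀ S : Set Q, setSum νL S ≤ e * setSum νR S + d)
    (K : Q → P → ℝ≥0∞) (hK : ∀ q, ∑' p, K q p = 1) (S : Set P) :
    setSum (fun p => ∑' q, νL q * K q p) S
      ≤ e * setSum (fun p => ∑' q, νR q * K q p) S + d := by
  have key : ∀ ν : Q → ℝ≥0∞, setSum (fun p => ∑' q, ν q * K q p) S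
      = ∑' q, ν q * ∑' p : S, K q p := by
    intro ν
    unfold setSum
    rw [ENNReal.tsum_comm]
    simp_rw [ENNReal.tsum_mul_left]
  rw [key, key, ← ENNReal.tsum_mul_left]
  have hle : ∀ q, ∑' p : S, K q p ≤ 1 := fun q =>
    (ENNReal.tsum_comp_le_tsum_of_injective Subtype.val_injective (K q)).trans (hK q).le
  calc ∑' q, νL q * ∑' p : S, K q p
      ≤ ∑' q, (e * (νR q * ∑' p : S, K q p) + (νL q - e * νR q)) := by
        refine ENNReal.tsum_le_tsum fun q => ?_
        calc νL q * ∑' p : S, K q p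
            ≤ (e * νR q + (νL q - e * νR q)) * ∑' p : S, K q p := by
              gcongr; exact le_add_tsub
          _ = e * (νR q * ∑' p : S, K q p) + (νL q - e * νR q) * ∑' p : S, K q p := by ring
          _ ≤ _ := by
              gcongr
              exact mul_le_of_le_one_right' (hle q)
    _ ≤ _ := by
        rw [ENNReal.tsum_add]
        gcongr
        exact dist_aux νL νR e d he hR h

theorem push_sub {Q P : Type*} (ν : Q → ℝ≥0∞) (h : IsSubDist ν)
    (K : Q → P → ℝ≥0∞) (hK : ∀ q, ∑' p, K q p = 1) :
    IsSubDist (fun p => ∑' q, ν q * K q p) := by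
  unfold IsSubDist at *
  rw [ENNReal.tsum_comm]
  simpa [ENNReal.tsum_mul_left, hK] using h

theorem tsum_option_enn {A : Type*} (g : Option A → ℝ≥0∞) :
    ∑' o, g o = g none + ∑' a, g (some a) := by
  have := (Equiv.optionEquivSumPUnit.{0} A).symm.tsum_eq g
  rw [← this, ENNReal.summable.tsum_sum ENNReal.summable]
  simp [add_comm]

theorem lift_push {A₁ A₂ B₁ B₂ : Type*} (ε δ : ℝ) (R : Set (A₁ × A₂)) (R' : Set (B₁ × B₂))
    (m₁ : A₁ → ℝ≥0∞) (m₂ : A₂ → ℝ≥0∞) (n₁ : B₁ → ℝ≥0∞) (n₂ : B₂ → ℝ≥0∞)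
    (K₁ : Option A₁ → Option B₁ → ℝ≥0∞) (K₂ : Option A₂ → Option B₂ → ℝ≥0∞)
    (hK₁ : ∀ x, ∑' y, K₁ x y = 1) (hK₂ : ∀ x, ∑' y, K₂ x y = 1)
    (hn₁ : ∀ b, ∑' a, m₁ a * K₁ (some a) (some b) = n₁ b)
    (hn₂ : ∀ b, ∑' a, m₂ a * K₂ (some a) (some b) = n₂ b)
    (hz₁ : ∀ a, m₁ a ≠ 0 → K₁ (some a) none = 0)
    (hz₂ : ∀ a, m₂ a ≠ 0 → K₂ (some a) none = 0)
    (hs₁ : ∀ b, K₁ none (some b) = 0) (hs₂ : ∀ b, K₂ none (some b) = 0)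
    (hR : ∀ a₁ a₂ b₁ b₂, K₁ (some a₁) (some b₁) ≠ 0 → K₂ (some a₂) (some b₂) ≠ 0 →
      (a₁, a₂) ∈ R → (b₁, b₂) ∈ R')
    (h : ApproxLift ε δ R m₁ m₂) : ApproxLift ε δ R' n₁ n₂ := by
  obtain ⟨νL, νR, hL, hRR, hmL, hL0, hmR, hR0, hsL, hsR, hd⟩ := h
  let K : Option A₁ × Option A₂ → Option B₁ × Option B₂ → ℝ≥0∞ :=
    fun q p => K₁ q.1 p.1 * K₂ q.2 p.2
  have hK : ∀ q, ∑' p, K q p = 1 := by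
    intro q
    rw [ENNReal.tsum_prod']
    simp only [K, ENNReal.tsum_mul_left, hK₂, mul_one, hK₁]
  have hLn : ∀ o, ∑' q, νL q * K q (none, o) = 0 := by
    intro o
    rw [ENNReal.tsum_eq_zero]
    rintro ⟨_ | a, y⟩
    · simp [hL0]
    · by_cases hm : m₁ a = 0
      · have := hmL a
        rw [hm, ENNReal.tsum_eq_zero] at this
        simp [this y]
      · simp [K, hz₁ a hm]
  have hRn : ∀ o, ∑' q, νR q * K q (o, none) = 0 := by
    intro o
    rw [ENNReal.tsum_eq_zero]
    rintro ⟨y, _ | a⟩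
    · simp [hR0]
    · by_cases hm : m₂ a = 0
      · have := hmR a
        rw [hm, ENNReal.tsum_eq_zero] at this
        simp [this y]
      · simp [K, hz₂ a hm]
  have hsupp : ∀ ν : Option A₁ × Option A₂ → ℝ≥0∞, {p | ν p ≠ 0} ⊆ starRel R →
      ∀ b₁ b₂, ∑' q, ν q * K q (some b₁, some b₂) ≠ 0 → (b₁, b₂) ∈ R' := by
    intro ν hν b₁ b₂ hne
    rw [ne_eq, ENNReal.tsum_eq_zero, not_forall] at hne
    obtain ⟨⟨x, y⟩, hq⟩ := hne
    have h1 : ν (x, y) ≠ 0 := fun h0 => hq (by simp [h0])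
    have h2 : K₁ x (some b₁) ≠ 0 := fun h0 => hq (by simp [K, h0])
    have h3 : K₂ y (some b₂) ≠ 0 := fun h0 => hq (by simp [K, h0])
    have h4 := hν h1
    rcases x with _ | x
    · exact absurd (hs₁ _) h2
    rcases y with _ | y
    · exact absurd (hs₂ _) h3
    exact hR x y b₁ b₂ h2 h3 h4
  refine ⟨fun p => ∑' q, νL q * K q p, fun p => ∑' q, νR q * K q p,
    push_sub _ hL _ hK, push_sub _ hRR _ hK, ?_, hLn, ?_, hRn, ?_, ?_,
    fun S => push_dist νL νR _ _ ENNReal.ofReal_ne_top hRR hd K hK S⟩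
  · intro b
    rw [ENNReal.tsum_comm]
    simp only [K, ENNReal.tsum_mul_left, hK₂, mul_one]
    rw [ENNReal.tsum_prod', ← hn₁ b, tsum_option_enn]
    simp only [ENNReal.tsum_mul_right, hmL, hL0]
    simp
  · intro b
    rw [ENNReal.tsum_comm]
    simp only [K, ENNReal.tsum_mul_left, ENNReal.tsum_mul_right, hK₁, one_mul]
    rw [ENNReal.tsum_prod', ENNReal.tsum_comm, ← hn₂ b, tsum_option_enn]
    simp only [ENNReal.tsum_mul_right, hmR, hR0]
    simp
  · rintro ⟨_ | b₁, _ | b₂⟩ hp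
    · exact absurd (hLn _) hp
    · trivial
    · trivial
    · exact hsupp νL hsL b₁ b₂ hp
  · rintro ⟨_ | b₁, _ | b₂⟩ hp
    · exact absurd (hRn _) hp
    · trivial
    · trivial
    · exact hsupp νR hsR b₁ b₂ hp

open Classical in
/-- Deterministic kernel. -/
def detK {A B : Type*} (f : A → B) (x : Option A) (y : Option B) : ℝ≥0∞ :=
  if y = x.map f then 1 else 0

open Classical in
/-- Conditional kernel of `μ` given the value of `f`. -/
def condK {A B : Type*} (μ : A → ℝ≥0∞) (f : A → B) : Option B → Option A → ℝ≥0∞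
  | none, none => 1
  | none, some _ => 0
  | some b, none => if setSum μ (f ⁻¹' {b}) = 0 then 1 else 0
  | some b, some a => if f a = b then μ a / setSum μ (f ⁻¹' {b}) else 0

open Classical in
theorem setSum_eq {A B : Type*} (μ : A → ℝ≥0∞) (f : A → B) (b : B) :
    setSum μ (f ⁻¹' {b}) = ∑' a, if f a = b then μ a else 0 := by
  unfold setSum
  rw [tsum_subtype]
  refine tsum_congr fun a => ?_
  simp [Set.indicator_apply]

theorem detK_sum {A B : Type*} (f : A → B) (x : Option A) : ∑' y, detK f x y = 1 := by
  classical
  simp [detK, tsum_ite_eq]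

theorem detK_marg {A B : Type*} (μ : A → ℝ≥0∞) (f : A → B) (b : B) :
    ∑' a, μ a * detK f (some a) (some b) = setSum μ (f ⁻¹' {b}) := by
  rw [setSum_eq]
  refine tsum_congr fun a => ?_
  by_cases hb : f a = b
  · simp [detK, hb]
  · simp [detK, hb, Ne.symm hb]

theorem setSum_zero {A B : Type*} (μ : A → ℝ≥0∞) (f : A → B) (a : A)
    (h : setSum μ (f ⁻¹' {f a}) = 0) : μ a = 0 := by
  rw [setSum_eq, ENNReal.tsum_eq_zero] at h
  simpa using h a

theorem setSum_fin {A : Type*} (μ : A → ℝ≥0∞) (h : IsSubDist μ) (S : Set A) :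
    setSum μ S ≠ ∞ :=
  ne_top_of_le_ne_top ENNReal.one_ne_top
    ((ENNReal.tsum_comp_le_tsum_of_injective Subtype.val_injective μ).trans h)

theorem condK_sum {A B : Type*} (μ : A → ℝ≥0∞) (h : IsSubDist μ) (f : A → B) (x : Option B) :
    ∑' y, condK μ f x y = 1 := by
  classical
  rw [tsum_option_enn]
  rcases x with _ | b
  · simp [condK]
  · have : ∑' a, condK μ f (some b) (some a)
        = setSum μ (f ⁻¹' {b}) / setSum μ (f ⁻¹' {b}) := by
      conv_rhs => rw [div_eq_mul_inv]; arg 1; rw [setSum_eq]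
      rw [← ENNReal.tsum_mul_right]
      refine tsum_congr fun a => ?_
      simp [condK, div_eq_mul_inv]
    rw [this]
    by_cases h0 : setSum μ (f ⁻¹' {b}) = 0
    · simp [condK, h0]
    · simp [condK, h0, ENNReal.div_self h0 (setSum_fin μ h _)]

theorem condK_marg {A B : Type*} (μ : A → ℝ≥0∞) (h : IsSubDist μ) (f : A → B) (a : A) :
    ∑' b, setSum μ (f ⁻¹' {b}) * condK μ f (some b) (some a) = μ a := by
  classical
  rw [tsum_eq_single (f a)]
  · simp only [condK, if_true]
    by_cases h0 : setSum μ (f ⁻¹' {f a}) = 0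
    · simp [h0, setSum_zero μ f a h0]
    · exact ENNReal.mul_div_cancel h0 (setSum_fin μ h _)
  · intro b hb
    simp [condK, hb.symm]

theorem condK_ne {A B : Type*} (μ : A → ℝ≥0∞) (f : A → B) (a : A) (b : B)
    (h : condK μ f (some b) (some a) ≠ 0) : f a = b := by
  by_contra hne
  simp [condK, hne] at h

theorem detK_ne {A B : Type*} (f : A → B) (a : A) (b : B)
    (h : detK f (some a) (some b) ≠ 0) : b = f a := by
  by_contra hne
  simp [detK, hne] at h

theorem alift_map {A₁ A₂ B₁ B₂ : Type*} [Countable A₁] [Countable A₂]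
    (μ₁ : A₁ → ℝ≥0∞) (μ₂ : A₂ → ℝ≥0∞)
    (h₁ : IsSubDist μ₁) (h₂ : IsSubDist μ₂)
    (f₁ : A₁ → B₁) (f₂ : A₂ → B₂) (R : Set (B₁ × B₂)) (ε δ : ℝ) :
    ApproxLift ε δ {p : A₁ × A₂ | (f₁ p.1, f₂ p.2) ∈ R} μ₁ μ₂ ↔
      ApproxLift ε δ R (fun b₁ => setSum μ₁ (f₁ ⁻¹' {b₁}))
        (fun b₂ => setSum μ₂ (f₂ ⁻¹' {b₂})) := by
  constructor
  · refine lift_push ε δ _ R μ₁ μ₂ _ _ (detK f₁) (detK f₂) (detK_sum f₁) (detK_sum f₂)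
      (detK_marg μ₁ f₁) (detK_marg μ₂ f₂) (by simp [detK]) (by simp [detK])
      (by simp [detK]) (by simp [detK]) ?_
    intro a₁ a₂ b₁ b₂ h1 h2 h
    rw [detK_ne _ _ _ h1, detK_ne _ _ _ h2]
    exact h
  · refine lift_push ε δ R _ _ _ μ₁ μ₂ (condK μ₁ f₁) (condK μ₂ f₂)
      (condK_sum μ₁ h₁ f₁) (condK_sum μ₂ h₂ f₂)
      (condK_marg μ₁ h₁ f₁) (condK_marg μ₂ h₂ f₂) ?_ ?_
      (by simp [condK]) (by simp [condK]) ?_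
    · intro b hb
      simp only [condK, if_neg hb]
    · intro b hb
      simp only [condK, if_neg hb]
    · intro b₁ b₂ a₁ a₂ h1 h2 h
      have e1 := condK_ne _ _ _ _ h1
      have e2 := condK_ne _ _ _ _ h2
      subst e1 e2
      exact h
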